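/- (Thomas–Yong) If T and T′ are jeu de taquin equivalent increasing tableaux of type A, then lis(T) = lis(T′) and lds(T) = lds(T′), where lis(T) and lds(T) denote the lengths of the longest strictly increasing and longest strictly decreasing subsequences of the row word of T. -/

import Mathlib

open Classical

noncomputable section

/-- A straight shape in a poset: a finite lower order ideal, given as a `Finset`. -/
def StraightShape {L : Type} [PartialOrder L] (lam : Finset L) : Prop :=
  ∀ a ∈ lam, ∀ b : L, b ≤ a → b ∈ lam

/-- The shape (set of boxes) of a partially defined tableau. -/
def shapeOf {L : Type} {V : Type} (T : L → Option V) : Set L := {α | T α ≠ none}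

/-- `lam ⊆ nu` is a pair of straight shapes, defining the skew shape `nu / lam`. -/
def IsSkewPair {L : Type} [PartialOrder L] (lam nu : Finset L) : Prop :=
  StraightShape lam ∧ StraightShape nu ∧ lam ⊆ nu

/-- `T` is defined on a skew shape `nu / lam`. -/
def HasSkewShape {L : Type} [PartialOrder L] (T : L → Option ℤ) : Prop :=
  ∃ lam nu : Finset L, IsSkewPair lam nu ∧ shapeOf T = (nu : Set L) \ (lam : Set L)

/-- `T` is strictly increasing along the partial order. -/
def Increasing {L : Type} [PartialOrder L] (T : L → Option ℤ) : Prop :=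
  ∀ a b : L, a < b → ∀ x y : ℤ, T a = some x → T b = some y → x < y

/-- An increasing tableau of skew shape. -/
def IncreasingSkewTableau {L : Type} [PartialOrder L] (T : L → Option ℤ) : Prop :=
  HasSkewShape T ∧ Increasing T

/-- Two boxes are neighbors if one covers the other. -/
def Neighbor {L : Type} [PartialOrder L] (a b : L) : Prop := a ⋖ b ∨ b ⋖ a

/-- The swap operation `swap_{s,s'}`. -/
def swapVal {L : Type} [PartialOrder L] {V : Type} (s s' : V) (T : L → Option V) :
    L → Option V := fun α =>
  if T α = some s ∧ ∃ β, Neighbor α β ∧ T β = some s' then some s'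
  else if T α = some s' ∧ ∃ β, Neighbor α β ∧ T β = some s then some s
  else T α

/-- Integer values extended with a dot `•`. -/
abbrev ZDot : Type := ℤ ⊕ Unit

def toDotted {L : Type} (T : L → Option ℤ) : L → Option ZDot := fun α => (T α).map Sum.inl

/-- Place a dot in every box of `C`. -/
def addDots {L : Type} (C : Finset L) (T : L → Option ZDot) : L → Option ZDot := fun α =>
  if α ∈ C then some (Sum.inr ()) else T α

/-- Restrict a dotted tableau to its integer-valued boxes. -/
def restrictInt {L : Type} (T : L → Option ZDot) : L → Option ℤ := fun α =>
  (T α).bind (Sum.elim some fun _ => none)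

/-- Apply `swap_{a,•}, swap_{a+1,•}, …, swap_{a+n-1,•}` in this (increasing) order. -/
def swapUp {L : Type} [PartialOrder L] (a : ℤ) : ℕ → (L → Option ZDot) → (L → Option ZDot)
  | 0, T => T
  | n + 1, T => swapVal (Sum.inl (a + n)) (Sum.inr ()) (swapUp a n T)

/-- Apply `swap_{b,•}, swap_{b-1,•}, …, swap_{b-n+1,•}` in this (decreasing) order. -/
def swapDown {L : Type} [PartialOrder L] (b : ℤ) : ℕ → (L → Option ZDot) → (L → Option ZDot)
  | 0, T => T
  | n + 1, T => swapVal (Sum.inl (b - n)) (Sum.inr ()) (swapDown b n T)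

/-- All values of `T` lie in the interval `[a, b]`. -/
def ValuesIn {L : Type} (T : L → Option ℤ) (a b : ℤ) : Prop :=
  ∀ (α : L) (x : ℤ), T α = some x → a ≤ x ∧ x ≤ b

/-- `T'` is obtained from `T` by a single forward jeu de taquin slide `jdt_C`,
starting from a set `C` of maximal boxes of the inner shape. -/
def IsForwardSlide {L : Type} [PartialOrder L] (T T' : L → Option ℤ) : Prop :=
  ∃ (lam nu C : Finset L) (a b : ℤ),
    IsSkewPair lam nu ∧ shapeOf T = (nu : Set L) \ (lam : Set L) ∧ ValuesIn T a b ∧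
    (∀ c ∈ C, c ∈ lam ∧ ∀ d ∈ lam, ¬ c < d) ∧
    T' = restrictInt (swapUp a (b - a + 1).toNat (addDots C (toDotted T)))

/-- `T'` is obtained from `T` by a single reverse jeu de taquin slide,
starting from a set `C` of minimal boxes of the complement of the outer shape. -/
def IsReverseSlide {L : Type} [PartialOrder L] (T T' : L → Option ℤ) : Prop :=
  ∃ (lam nu C : Finset L) (a b : ℤ),
    IsSkewPair lam nu ∧ shapeOf T = (nu : Set L) \ (lam : Set L) ∧ ValuesIn T a b ∧
    (∀ c ∈ C, c ∉ nu ∧ ∀ d : L, d ∉ nu → ¬ d < c) ∧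
    T' = restrictInt (swapDown b (b - a + 1).toNat (addDots C (toDotted T)))

/-- Jeu de taquin equivalence: a finite sequence of forward and reverse slides. -/
def JdtEquiv {L : Type} [PartialOrder L] (T T' : L → Option ℤ) : Prop :=
  Relation.ReflTransGen (fun A B => IsForwardSlide A B ∨ IsReverseSlide A B) T T'

/-- `T` is defined on a straight shape. -/
def HasStraightShape {L : Type} [PartialOrder L] (T : L → Option ℤ) : Prop :=
  ∃ lam : Finset L, StraightShape lam ∧ shapeOf T = (lam : Set L)

/-- `U` is a rectification of `T`: a straight-shape tableau obtained by forward slides. -/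
def RectifiesTo {L : Type} [PartialOrder L] (T U : L → Option ℤ) : Prop :=
  Relation.ReflTransGen IsForwardSlide T U ∧ HasStraightShape U

/-- Unique rectification target. -/
def IsURT {L : Type} [PartialOrder L] (U : L → Option ℤ) : Prop :=
  HasStraightShape U ∧ Increasing U ∧
    ∀ T : L → Option ℤ, IncreasingSkewTableau T → RectifiesTo T U →
      ∀ U' : L → Option ℤ, RectifiesTo T U' → U' = U

/-- The minimal increasing tableau of a shape `θ`: each box `α` receives the maximal
cardinality of a totally ordered subset of `θ` having `α` as its maximal element. -/
def minTab {L : Type} [PartialOrder L] (θ : Finset L) : L → Option ℤ := fun α =>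
  if α ∈ θ then
    some ((sSup {n : ℕ | ∃ s : Finset L, (s : Set L) ⊆ (θ : Set L) ∧
      (∀ a ∈ s, ∀ b ∈ s, a ≤ b ∨ b ≤ a) ∧ α ∈ s ∧ (∀ a ∈ s, a ≤ α) ∧ s.card = n} : ℕ) : ℤ)
  else none

/-- A unique rectification poset. -/
def IsURP (L : Type) [PartialOrder L] : Prop :=
  ∀ lam : Finset L, StraightShape lam → IsURT (minTab lam)

/-- The structure constant `c^ν_{λ,μ}`: the number of increasing tableaux of
shape `ν/λ` that have the minimal increasing tableau `M_μ` as a rectification. -/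
def ccoef {L : Type} [PartialOrder L] (lam mu nu : Finset L) : ℕ :=
  Set.ncard {T : L → Option ℤ | Increasing T ∧ shapeOf T = (nu : Set L) \ (lam : Set L) ∧
    RectifiesTo T (minTab mu)}

/-- The row word of a tableau on boxes in `ℕ × ℕ`: entries are read row by row
from left to right, starting with the bottom row; `rmax` and `cmax` are bounds
enclosing the shape. -/
def rowWord (T : ℕ × ℕ → Option ℤ) (rmax cmax : ℕ) : List ℤ :=
  (List.range (rmax + 1)).reverse.flatMap fun r =>
    (List.range (cmax + 1)).filterMap fun c => T (r, c)

/-- The shape of `T` is contained in the rectangle `[0, rmax] × [0, cmax]`. -/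
def BoundedBy (T : ℕ × ℕ → Option ℤ) (rmax cmax : ℕ) : Prop :=
  ∀ p : ℕ × ℕ, T p ≠ none → p.1 ≤ rmax ∧ p.2 ≤ cmax

/-- The length of the longest strictly increasing subsequence of a word. -/
def lisOf (w : List ℤ) : ℕ :=
  sSup {n : ℕ | ∃ s : List ℤ, s.Sublist w ∧ s.Chain' (· < ·) ∧ s.length = n}

/-- The length of the longest strictly decreasing subsequence of a word. -/
def ldsOf (w : List ℤ) : ℕ :=
  sSup {n : ℕ | ∃ s : List ℤ, s.Sublist w ∧ s.Chain' (· > ·) ∧ s.length = n}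

section Chains

variable {L : Type} (row col : L → ℤ)

/-- `q` lies weakly above and strictly to the right of `p`, and carries a larger value. -/
def NELt (F : L → ℤ) (p q : L) : Prop :=
  F p < F q ∧ col p < col q ∧ row q ≤ row p

/-- `q` lies one row below `p` and strictly to the right of it, and a box of `D` with value `e`
separates the two in one of the two rows. -/
def DropLt (D : Set L) (F : L → ℤ) (e : ℤ) (p q : L) : Prop :=
  F p < e ∧ e < F q ∧ col p < col q ∧ row q = row p + 1 ∧
    ∃ d ∈ D, F d = e ∧ ((row d = row p ∧ col p < col d ∧ col d ≤ col q) ∨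
      (row d = row q ∧ col p ≤ col d ∧ col d < col q))

/-- There is a north-east chain of length `n` in `D` avoiding the value `e`, except that its step
across the value `e` may be a `DropLt` step. -/
def HasDropChain (D : Set L) (F : L → ℤ) (e : ℤ) (n : ℕ) : Prop :=
  ∃ l₁ l₂ : List L, l₁.length + l₂.length = n ∧
    (∀ p ∈ l₁, p ∈ D ∧ F p < e) ∧ (∀ p ∈ l₂, p ∈ D ∧ e < F p) ∧
    l₁.IsChain (NELt row col F) ∧ l₂.IsChain (NELt row col F) ∧
    ∀ p ∈ l₁.getLast?, ∀ q ∈ l₂.head?, NELt row col F p q ∨ DropLt row col D F e p q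

/-- `F` and `G` are increasing fillings of a convex set `D` of boxes, related by swapping the
value `t` with the holes; a hole has value `t - 1` in `F` and `t + 1` in `G`. -/
structure HoleSwap (D : Set L) (F G : L → ℤ) (t : ℤ) : Prop where
  inj : ∀ p q, row p = row q → col p = col q → p = q
  box : ∀ p ∈ D, ∀ q ∈ D, ∀ r c, row p ≤ r → r ≤ row q → col p ≤ c → c ≤ col q →
    ∃ m ∈ D, row m = r ∧ col m = c
  monoF : ∀ p ∈ D, ∀ q ∈ D, row p ≤ row q → col p ≤ col q → p ≠ q → F p < F q
  monoG : ∀ p ∈ D, ∀ q ∈ D, row p ≤ row q → col p ≤ col q → p ≠ q → G p < G q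
  vals : ∀ p ∈ D, (F p = G p ∧ (F p < t - 1 ∨ t + 1 < F p)) ∨
    ((F p = t - 1 ∨ F p = t) ∧ (G p = t ∨ G p = t + 1))
  hole : ∀ p ∈ D, F p = t - 1 → G p = t → ∃ q ∈ D, F q = t ∧ G q = t + 1 ∧
    ((row q = row p ∧ col q = col p + 1) ∨ (row q = row p + 1 ∧ col q = col p))
  entry : ∀ q ∈ D, F q = t → G q = t + 1 → ∃ p ∈ D, F p = t - 1 ∧ G p = t ∧
    ((row q = row p ∧ col q = col p + 1) ∨ (row q = row p + 1 ∧ col q = col p))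

variable {row col}

theorem HoleSwap.rotate {D : Set L} {F G : L → ℤ} {t : ℤ} (h : HoleSwap row col D F G t) :
    HoleSwap (-row) (-col) D (-G) (-F) (-t) where
  inj p q h1 h2 := h.inj p q (by simpa using h1) (by simpa using h2)
  box p hp q hq r c h1 h2 h3 h4 := by
    simp only [Pi.neg_apply] at *
    obtain ⟨m, hm, e1, e2⟩ := h.box q hq p hp (-r) (-c) (by omega) (by omega) (by omega) (by omega)
    exact ⟨m, hm, by omega, by omega⟩
  monoF p hp q hq h1 h2 h3 := by
    simp only [Pi.neg_apply] at *
    have := h.monoG q hq p hp (by omega) (by omega) h3.symm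
    omega
  monoG p hp q hq h1 h2 h3 := by
    simp only [Pi.neg_apply] at *
    have := h.monoF q hq p hp (by omega) (by omega) h3.symm
    omega
  vals p hp := by
    have := h.vals p hp
    simp only [Pi.neg_apply]
    omega
  hole p hp h1 h2 := by
    simp only [Pi.neg_apply] at *
    obtain ⟨q, hq, h3, h4, h5⟩ := h.entry p hp (by omega) (by omega)
    exact ⟨q, hq, by omega, by omega, by omega⟩
  entry p hp h1 h2 := by
    simp only [Pi.neg_apply] at *
    obtain ⟨q, hq, h3, h4, h5⟩ := h.hole p hp (by omega) (by omega)
    exact ⟨q, hq, by omega, by omega, by omega⟩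

theorem HasDropChain.rotate {D : Set L} {F : L → ℤ} {e : ℤ} {n : ℕ}
    (h : HasDropChain row col D F e n) : HasDropChain (-row) (-col) D (-F) (-e) n := by
  obtain ⟨l₁, l₂, hn, h1, h2, c1, c2, hc⟩ := h
  have key : ∀ p q, NELt row col F p q → NELt (-row) (-col) (-F) q p := by
    intro p q
    simp only [NELt, Pi.neg_apply]
    omega
  refine ⟨l₂.reverse, l₁.reverse, by simp; omega, ?_, ?_, ?_, ?_, ?_⟩
  · intro p hp
    have := h2 p (by simpa using hp)
    exact ⟨this.1, by simp only [Pi.neg_apply]; omega⟩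
  · intro p hp
    have := h1 p (by simpa using hp)
    exact ⟨this.1, by simp only [Pi.neg_apply]; omega⟩
  · rw [List.isChain_reverse]
    exact c2.imp key
  · rw [List.isChain_reverse]
    exact c1.imp key
  · intro p hp q hq
    rw [List.getLast?_reverse] at hp
    rw [List.head?_reverse] at hq
    rcases hc q hq p hp with h | ⟨h3, h4, h5, h6, d, hd, h7, h8⟩
    · left
      simp only [NELt, Pi.neg_apply] at *
      omega
    · right
      refine ⟨?_, ?_, ?_, ?_, d, hd, ?_, ?_⟩ <;> simp only [Pi.neg_apply] at * <;> omega

/-- A north-east chain ending in `p` may be pushed down so as to end in the box below `p`. -/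
theorem exists_chain_below {D : Set L} {G : L → ℤ}
    (hbox : ∀ p ∈ D, ∀ q ∈ D, ∀ r c, row p ≤ r → r ≤ row q → col p ≤ c → c ≤ col q →
      ∃ m ∈ D, row m = r ∧ col m = c)
    (hmono : ∀ p ∈ D, ∀ q ∈ D, row p ≤ row q → col p ≤ col q → p ≠ q → G p < G q)
    (l : List L) : ∀ p p' : L, (∀ x ∈ l, x ∈ D) → p ∈ D → p' ∈ D →
      row p' = row p + 1 → col p' = col p → (l ++ [p]).IsChain (NELt row col G) →
      ∃ l' : List L, l'.length = l.length ∧ (∀ x ∈ l', x ∈ D ∧ G x < G p') ∧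
        (l' ++ [p']).IsChain (NELt row col G) := by
  induction l using List.reverseRecOn with
  | nil => exact fun p p' _ _ _ _ _ _ => ⟨[], rfl, by simp, by simp⟩
  | append_singleton l o ih =>
    intro p p' hl hp hp' hr hc hch
    have ho : o ∈ D := hl o (by simp)
    rw [List.isChain_append] at hch
    obtain ⟨hlo, -, hop⟩ := hch
    obtain ⟨h1, h2, h3⟩ := hop o (by simp) p (by simp)
    have hpp : G p < G p' := hmono p hp p' hp' (by omega) (by omega) (by rintro rfl; omega)
    by_cases hro : row p' ≤ row o
    · refine ⟨l ++ [o], by simp, ?_, ?_⟩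
      · intro x hx
        refine ⟨hl x hx, ?_⟩
        have hT : IsTrans L (NELt row col G) :=
          ⟨fun a b c h h' => ⟨h.1.trans h'.1, h.2.1.trans h'.2.1, h'.2.2.trans h.2.2⟩⟩
        rw [List.isChain_iff_pairwise, List.pairwise_append] at hlo
        rcases List.mem_append.1 hx with hx | hx
        · have := (hlo.2.2 x hx o (by simp)).1
          omega
        · rw [List.mem_singleton.1 hx]
          omega
      · rw [List.isChain_append]
        refine ⟨hlo, by simp, ?_⟩
        simp only [List.getLast?_concat, List.head?_cons, Option.mem_some_iff]
        rintro _ rfl _ rfl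
        exact ⟨by omega, by omega, by omega⟩
    · obtain ⟨o', ho', h4, h5⟩ := hbox o ho p' hp' (row o + 1) (col o) (by omega) (by omega)
        (by omega) (by omega)
      obtain ⟨l', h6, h7, h8⟩ := ih o o' (fun x hx => hl x (by simp [hx])) ho ho' h4 h5 hlo
      have h9 : G o' < G p' := hmono o' ho' p' hp' (by omega) (by omega) (by rintro rfl; omega)
      refine ⟨l' ++ [o'], by simp [h6], ?_, ?_⟩
      · intro x hx
        rcases List.mem_append.1 hx with hx | hx
        · exact ⟨(h7 x hx).1, (h7 x hx).2.trans h9⟩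
        · rw [List.mem_singleton.1 hx]
          exact ⟨ho', h9⟩
      · rw [List.isChain_append]
        refine ⟨h8, by simp, ?_⟩
        simp only [List.getLast?_concat, List.head?_cons, Option.mem_some_iff]
        rintro _ rfl _ rfl
        exact ⟨by omega, by omega, by omega⟩

theorem isChain_NELt_congr {F G : L → ℤ} {l : List L} (h : ∀ x ∈ l, F x = G x)
    (hl : l.IsChain (NELt row col F)) : l.IsChain (NELt row col G) := by
  refine hl.imp_of_mem_imp ?_
  intro a b ha hb hab
  rw [NELt, ← h a ha, ← h b hb]
  exact hab

theorem HasDropChain.of_concat {D : Set L} {G : L → ℤ} {e : ℤ} {l : List L} {x : L} {l₂ : List L}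
    (hl : ∀ p ∈ l, p ∈ D ∧ G p < e) (hx : x ∈ D) (hxe : G x < e)
    (hl₂ : ∀ p ∈ l₂, p ∈ D ∧ e < G p) (c₁ : l.IsChain (NELt row col G))
    (c₂ : l₂.IsChain (NELt row col G)) (h₁ : ∀ p ∈ l.getLast?, NELt row col G p x)
    (h₂ : ∀ q ∈ l₂.head?, NELt row col G x q ∨ DropLt row col D G e x q) :
    HasDropChain row col D G e (l.length + (l₂.length + 1)) := by
  refine ⟨l ++ [x], l₂, by simp; omega, ?_, hl₂, ?_, c₂, ?_⟩
  · intro p hp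
    rcases List.mem_append.1 hp with hp | hp
    · exact hl p hp
    · rw [List.mem_singleton.1 hp]
      exact ⟨hx, hxe⟩
  · rw [List.isChain_append]
    refine ⟨c₁, by simp, ?_⟩
    intro p hp q hq
    simp only [List.head?_cons, Option.mem_some_iff] at hq
    exact hq ▸ h₁ p hp
  · intro p hp q hq
    simp only [List.getLast?_concat, Option.mem_some_iff] at hp
    exact hp ▸ h₂ q hq

theorem HoleSwap.hasDropChain_of {D : Set L} {F G : L → ℤ} {t : ℤ} (h : HoleSwap row col D F G t)
    {n : ℕ} (hc : HasDropChain row col D F (t - 1) n) : HasDropChain row col D G (t + 1) n := by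
  obtain ⟨l₁, l₂, rfl, h1, h2, c1, c2, hc⟩ := hc
  have h1G : ∀ p ∈ l₁, F p = G p := fun p hp => by
    have := h.vals p (h1 p hp).1
    have := (h1 p hp).2
    omega
  have c1G := isChain_NELt_congr h1G c1
  have h1' : ∀ p ∈ l₁, p ∈ D ∧ G p < t + 1 := fun p hp =>
    ⟨(h1 p hp).1, by have := (h1 p hp).2; have := h1G p hp; omega⟩
  rcases l₂ with - | ⟨q, l₃⟩
  · exact ⟨l₁, [], rfl, h1', by simp, c1G, by simp, by simp⟩
  have hq := (h2 q (by simp)).1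
  have hqe := (h2 q (by simp)).2
  have h3 : ∀ p ∈ l₃, p ∈ D ∧ F q < F p := by
    have hT : IsTrans L (NELt row col F) :=
      ⟨fun a b c h h' => ⟨h.1.trans h'.1, h.2.1.trans h'.2.1, h'.2.2.trans h.2.2⟩⟩
    rw [List.isChain_iff_pairwise, List.pairwise_cons] at c2
    exact fun p hp => ⟨(h2 p (by simp [hp])).1, (c2.1 p hp).1⟩
  have h3G : ∀ p ∈ l₃, F p = G p := fun p hp => by
    have := h.vals p (h3 p hp).1
    have := (h3 p hp).2
    omega
  have h3' : ∀ p ∈ l₃, p ∈ D ∧ t + 1 < G p := fun p hp =>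
    ⟨(h3 p hp).1, by
      have := (h3 p hp).2; have := h3G p hp; have := h.vals p (h3 p hp).1; omega⟩
  have c2q := c2
  rw [List.isChain_cons] at c2
  obtain ⟨hq3, c3⟩ := c2
  have c3G := isChain_NELt_congr h3G c3
  have hy : ∀ y ∈ l₃.head?, t + 1 < G y ∧ F y = G y ∧ col q < col y ∧ row y ≤ row q := by
    intro y hy
    have hm := List.mem_of_mem_head? hy
    obtain ⟨-, h4, h5⟩ := hq3 y hy
    exact ⟨(h3' y hm).2, h3G y hm, h4, h5⟩
  have hp : ∀ p ∈ l₁.getLast?, p ∈ D ∧ F p < t - 1 ∧ F p = G p := by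
    intro p hp
    have hm := List.mem_of_mem_getLast? hp
    exact ⟨(h1 p hm).1, (h1 p hm).2, h1G p hm⟩
  have hvq := h.vals q hq
  -- A replacement box may reach the rest of the chain through the hole left in row `row x + 1`.
  have below : ∀ x m, m ∈ D → G m = t + 1 → G x < t + 1 → row q ≤ row x + 1 → col x ≤ col q →
      ((row m = row x ∧ col x < col m ∧ col m ≤ col q + 1) ∨
        (row m = row x + 1 ∧ col x ≤ col m ∧ col m ≤ col q)) →
      ∀ y ∈ l₃.head?, NELt row col G x y ∨ DropLt row col D G (t + 1) x y := by
    intro x m hm hGm hGx hr hcq hpos y hyy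
    obtain ⟨a1, a2, a3, a4⟩ := hy y hyy
    by_cases hrow : row y ≤ row x
    · exact Or.inl ⟨by omega, by omega, hrow⟩
    · exact Or.inr ⟨hGx, a1, by omega, by omega, m, hm, hGm, by omega⟩
  by_cases hne : ∀ p ∈ l₁.getLast?, NELt row col F p q
  · by_cases hGq : G q = t + 1 ∧ F q = t
    · obtain ⟨d, hd, hFd, hGd, hpos⟩ := h.entry q hq hGq.2 hGq.1
      refine HasDropChain.of_concat h1' hd (by omega) h3' c1G c3G ?_ ?_
      · intro p hpp
        obtain ⟨b1, b2, b3⟩ := hp p hpp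
        obtain ⟨e1, e2, e3⟩ := hne p hpp
        refine ⟨by omega, ?_, by omega⟩
        by_contra hcol
        have := h.monoF d hd p b1 (by omega) (by omega) (by rintro rfl; omega)
        omega
      · intro y hyy
        rcases hpos with hpos | hpos
        · obtain ⟨a1, a2, a3, a4⟩ := hy y hyy
          exact Or.inl ⟨by omega, by omega, by omega⟩
        · exact below d q hq hGq.1 (by omega) (by omega) (by omega) (by omega) y hyy
    · by_cases hGt : G q = t
      · refine HasDropChain.of_concat h1' hq (by omega) h3' c1G c3G ?_ ?_
        · intro p hpp
          obtain ⟨b1, b2, b3⟩ := hp p hpp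
          obtain ⟨e1, e2, e3⟩ := hne p hpp
          exact ⟨by omega, e2, e3⟩
        · intro y hyy
          obtain ⟨a1, a2, a3, a4⟩ := hy y hyy
          exact Or.inl ⟨by omega, a3, a4⟩
      · have hFG : F q = G q := by omega
        refine ⟨l₁, q :: l₃, rfl, h1', ?_, c1G, ?_, ?_⟩
        · intro p hpp
          rcases List.mem_cons.1 hpp with rfl | hpp
          · exact ⟨hq, by omega⟩
          · exact h3' p hpp
        · refine isChain_NELt_congr ?_ c2q
          intro p hpp
          rcases List.mem_cons.1 hpp with rfl | hpp
          · exact hFG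
          · exact h3G p hpp
        · intro p hpp y hyy
          simp only [List.head?_cons, Option.mem_some_iff] at hyy
          subst hyy
          obtain ⟨b1, b2, b3⟩ := hp p hpp
          obtain ⟨e1, e2, e3⟩ := hne p hpp
          exact Or.inl ⟨by omega, e2, e3⟩
  push Not at hne
  obtain ⟨p, hpl, hnpq⟩ := hne
  obtain ⟨l₀, rfl⟩ := List.getLast?_eq_some_iff.1 hpl
  obtain ⟨hpD, hFp, hFGp⟩ := hp p hpl
  obtain ⟨-, -, hcpq, hrpq, d, hd, hFd, hpos⟩ := (hc p hpl q (by simp)).resolve_left hnpq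
  have hvd := h.vals d hd
  have hcat : ∀ x ∈ D, G x < t + 1 → NELt row col G p x →
      (∀ y ∈ l₃.head?, NELt row col G x y ∨ DropLt row col D G (t + 1) x y) →
      HasDropChain row col D G (t + 1) ((l₀ ++ [p]).length + (l₃.length + 1)) := by
    intro x hx hGx hpx hxy
    refine HasDropChain.of_concat h1' hx hGx h3' c1G c3G ?_ hxy
    simp only [List.getLast?_concat, Option.mem_some_iff]
    rintro _ rfl
    exact hpx
  have push_down : ∀ p' ∈ D, row p' = row p + 1 → col p' = col p →
      ∃ l' : List L, l'.length = l₀.length ∧ (∀ x ∈ l', x ∈ D ∧ G x < G p') ∧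
        (l' ++ [p']).IsChain (NELt row col G) := fun p' hp' e1 e2 =>
    exists_chain_below h.box h.monoG l₀ p p' (fun x hx => (h1 x (by simp [hx])).1) hpD hp' e1 e2 c1G
  by_cases hFq : F q = t
  · have hdq := h.monoG d hd q hq (by omega) (by omega) (by rintro rfl; omega)
    have hGq : G q = t + 1 := by omega
    have hGd : G d = t := by omega
    rcases hpos with hpos | hpos
    · have hcd : col d = col q := by
        by_contra hne
        obtain ⟨m, hm, e1, e2⟩ := h.box d hd q hq (row q) (col d) (by omega) le_rfl le_rfl
          (by omega)
        have := h.monoF d hd m hm (by omega) (by omega) (by rintro rfl; omega)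
        have := h.monoF m hm q hq (by omega) (by omega) (by rintro rfl; omega)
        omega
      exact hcat d hd (by omega) ⟨by omega, by omega, by omega⟩
        (below d q hq hGq (by omega) (by omega) (by omega) (by omega))
    · have hcd : col q = col d + 1 := by
        by_contra hne
        obtain ⟨m, hm, e1, e2⟩ := h.box d hd q hq (row q) (col d + 1) (by omega) le_rfl (by omega)
          (by omega)
        have := h.monoF d hd m hm (by omega) (by omega) (by rintro rfl; omega)
        have := h.monoF m hm q hq (by omega) (by omega) (by rintro rfl; omega)
        omega
      by_cases hcp : col p < col d
      · obtain ⟨p', hp', e1, e2⟩ := h.box p hpD d hd (row p + 1) (col p) (by omega) (by omega)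
          le_rfl (by omega)
        obtain ⟨l', f1, f2, f3⟩ := push_down p' hp' e1 e2
        have hp'd := h.monoG p' hp' d hd (by omega) (by omega) (by rintro rfl; omega)
        have := HasDropChain.of_concat (e := t + 1) (l := l' ++ [p']) (x := d) (l₂ := l₃) ?_ hd
          (by omega) h3' f3 c3G ?_ ?_
        · simpa [f1] using this
        · intro x hx
          rcases List.mem_append.1 hx with hx | hx
          · exact ⟨(f2 x hx).1, by have := (f2 x hx).2; omega⟩
          · rw [List.mem_singleton.1 hx]
            exact ⟨hp', by omega⟩
        · simp only [List.getLast?_concat, Option.mem_some_iff]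
          rintro _ rfl
          exact ⟨hp'd, by omega, by omega⟩
        · intro y hyy
          obtain ⟨a1, a2, a3, a4⟩ := hy y hyy
          exact Or.inl ⟨by omega, by omega, by omega⟩
      · obtain ⟨x, hx, e1, e2⟩ := h.box p hpD q hq (row p) (col q) le_rfl (by omega) (by omega)
          le_rfl
        have g1 := h.monoG p hpD x hx (by omega) (by omega) (by rintro rfl; omega)
        have g2 := h.monoG x hx q hq (by omega) (by omega) (by rintro rfl; omega)
        exact hcat x hx (by omega) ⟨g1, by omega, by omega⟩
          (below x q hq hGq (by omega) (by omega) (by omega) (by omega))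
  have hFG : F q = G q := by omega
  have hq3' : ∀ p ∈ q :: l₃, p ∈ D ∧ t + 1 < G p := by
    intro p hpp
    rcases List.mem_cons.1 hpp with rfl | hpp
    · exact ⟨hq, by omega⟩
    · exact h3' p hpp
  have cqG : (q :: l₃).IsChain (NELt row col G) := by
    refine isChain_NELt_congr ?_ c2q
    intro p hpp
    rcases List.mem_cons.1 hpp with rfl | hpp
    · exact hFG
    · exact h3G p hpp
  have keep : ∀ m ∈ D, G m = t + 1 → ((row m = row p ∧ col p < col m ∧ col m ≤ col q) ∨
      (row m = row q ∧ col p ≤ col m ∧ col m < col q)) →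
      HasDropChain row col D G (t + 1) ((l₀ ++ [p]).length + (l₃.length + 1)) := by
    intro m hm hGm hmpos
    refine ⟨l₀ ++ [p], q :: l₃, rfl, h1', hq3', c1G, cqG, ?_⟩
    simp only [List.getLast?_concat, List.head?_cons, Option.mem_some_iff]
    rintro _ rfl _ rfl
    exact Or.inr ⟨by omega, by omega, hcpq, hrpq, m, hm, hGm, hmpos⟩
  by_cases hGd : G d = t + 1
  · exact keep d hd hGd hpos
  have hGd : G d = t := by omega
  rcases hpos with hpos | hpos
  · obtain ⟨m, hm, hFm, hGm, hmpos⟩ := h.hole d hd hFd hGd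
    have hmq : row m = row q → col m = col q → False := fun e1 e2 => by
      rw [h.inj m q e1 e2] at hFm
      omega
    by_cases hmk : (row m = row p ∧ col p < col m ∧ col m ≤ col q) ∨
      (row m = row q ∧ col p ≤ col m ∧ col m < col q)
    · exact keep m hm hGm hmk
    · exact hcat d hd (by omega) ⟨by omega, by omega, by omega⟩
        (below d m hm hGm (by omega) (by omega) (by omega) (by omega))
  · obtain ⟨p', hp', e1, e2⟩ := h.box p hpD d hd (row p + 1) (col p) (by omega) (by omega)
      le_rfl (by omega)
    obtain ⟨l', f1, f2, f3⟩ := push_down p' hp' e1 e2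
    have hp'd : G p' ≤ G d := by
      by_cases hpd : p' = d
      · rw [hpd]
      · exact (h.monoG p' hp' d hd (by omega) (by omega) hpd).le
    refine ⟨l' ++ [p'], q :: l₃, by simp [f1], ?_, hq3', f3, cqG, ?_⟩
    · intro x hx
      rcases List.mem_append.1 hx with hx | hx
      · exact ⟨(f2 x hx).1, by have := (f2 x hx).2; omega⟩
      · rw [List.mem_singleton.1 hx]
        exact ⟨hp', by omega⟩
    · simp only [List.getLast?_concat, List.head?_cons, Option.mem_some_iff]
      rintro _ rfl _ rfl
      exact Or.inl ⟨by omega, hcpq.trans_eq' (by omega), by omega⟩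

theorem HoleSwap.hasDropChain_iff {D : Set L} {F G : L → ℤ} {t : ℤ}
    (h : HoleSwap row col D F G t) {n : ℕ} :
    HasDropChain row col D F (t - 1) n ↔ HasDropChain row col D G (t + 1) n := by
  refine ⟨h.hasDropChain_of, fun hG => ?_⟩
  have h1 := hG.rotate
  rw [show -(t + 1) = -t - 1 by ring] at h1
  have h2 := (h.rotate.hasDropChain_of h1).rotate
  rw [show -(-t + 1) = t - 1 by ring] at h2
  simpa only [neg_neg] using h2

end Chains

theorem HoleSwap.transpose {L : Type} {row col : L → ℤ} {D : Set L} {F G : L → ℤ} {t : ℤ}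
    (h : HoleSwap row col D F G t) : HoleSwap col row D F G t where
  inj p q h1 h2 := h.inj p q h2 h1
  box p hp q hq r c h1 h2 h3 h4 := by
    obtain ⟨m, hm, e1, e2⟩ := h.box p hp q hq c r h3 h4 h1 h2
    exact ⟨m, hm, e2, e1⟩
  monoF p hp q hq h1 h2 := h.monoF p hp q hq h2 h1
  monoG p hp q hq h1 h2 := h.monoG p hp q hq h2 h1
  vals := h.vals
  hole p hp h1 h2 := by
    obtain ⟨q, hq, h3, h4, h5⟩ := h.hole p hp h1 h2
    exact ⟨q, hq, h3, h4, by tauto⟩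
  entry p hp h1 h2 := by
    obtain ⟨q, hq, h3, h4, h5⟩ := h.entry p hp h1 h2
    exact ⟨q, hq, h3, h4, by tauto⟩

section Swap

variable {L : Type}

/-- The integer filling which doubles the entries of `S` and gives every dot the value `e`. -/
def boxVal (e : ℤ) (S : L → Option ZDot) (p : L) : ℤ :=
  (S p).elim 0 (Sum.elim (fun x => 2 * x) fun _ => e)

theorem boxVal_inl {e x : ℤ} {S : L → Option ZDot} {p : L} (h : S p = some (Sum.inl x)) :
    boxVal e S p = 2 * x := by
  simp [boxVal, h]

theorem boxVal_inr {e : ℤ} {S : L → Option ZDot} {p : L} (h : S p = some (Sum.inr ())) :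
    boxVal e S p = e := by
  simp [boxVal, h]

variable [PartialOrder L]

/-- `S` has convex shape and is increasing when every dot has the value `e` and every entry is
doubled. -/
structure GoodDots (S : L → Option ZDot) (e : ℤ) : Prop where
  convex : (shapeOf S).OrdConnected
  mono : ∀ p ∈ shapeOf S, ∀ q ∈ shapeOf S, p < q → boxVal e S p < boxVal e S q

theorem Neighbor.symm {p q : L} (h : Neighbor p q) : Neighbor q p := Or.symm h

theorem swapVal_cases (s : ℤ) (S : L → Option ZDot) (p : L) :
    (S p = none ∧ swapVal (Sum.inl s) (Sum.inr ()) S p = none) ∨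
    (S p = some (Sum.inr ()) ∧ swapVal (Sum.inl s) (Sum.inr ()) S p = some (Sum.inr ()) ∧
      ∀ q, Neighbor p q → S q ≠ some (Sum.inl s)) ∨
    (S p = some (Sum.inr ()) ∧ swapVal (Sum.inl s) (Sum.inr ()) S p = some (Sum.inl s) ∧
      ∃ q, Neighbor p q ∧ S q = some (Sum.inl s) ∧
        swapVal (Sum.inl s) (Sum.inr ()) S q = some (Sum.inr ())) ∨
    (S p = some (Sum.inl s) ∧ swapVal (Sum.inl s) (Sum.inr ()) S p = some (Sum.inl s) ∧
      ∀ q, Neighbor p q → S q ≠ some (Sum.inr ())) ∨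
    (S p = some (Sum.inl s) ∧ swapVal (Sum.inl s) (Sum.inr ()) S p = some (Sum.inr ()) ∧
      ∃ q, Neighbor p q ∧ S q = some (Sum.inr ()) ∧
        swapVal (Sum.inl s) (Sum.inr ()) S q = some (Sum.inl s)) ∨
    ∃ x, x ≠ s ∧ S p = some (Sum.inl x) ∧
      swapVal (Sum.inl s) (Sum.inr ()) S p = some (Sum.inl x) := by
  rcases hp : S p with - | x | ⟨⟩
  · simp [swapVal, hp]
  · by_cases hx : x = s
    · subst hx
      by_cases hq : ∃ q, Neighbor p q ∧ S q = some (Sum.inr ())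
      · have hq' := hq
        obtain ⟨q, hpq, hSq⟩ := hq
        have h1 : ∃ β, Neighbor q β ∧ S β = some (Sum.inl x) := ⟨p, hpq.symm, hp⟩
        refine Or.inr <| Or.inr <| Or.inr <| Or.inr <| Or.inl ⟨rfl, ?_, q, hpq, hSq, ?_⟩
        · simp [swapVal, hp, hq']
        · simp [swapVal, hSq, h1]
      · refine Or.inr <| Or.inr <| Or.inr <| Or.inl ⟨rfl, ?_, fun q h1 h2 => hq ⟨q, h1, h2⟩⟩
        simp [swapVal, hp, hq]
    · refine Or.inr <| Or.inr <| Or.inr <| Or.inr <| Or.inr ⟨x, hx, rfl, ?_⟩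
      simp [swapVal, hp, hx]
  · by_cases hq : ∃ q, Neighbor p q ∧ S q = some (Sum.inl s)
    · have hq' := hq
      obtain ⟨q, hpq, hSq⟩ := hq
      have h1 : ∃ β, Neighbor q β ∧ S β = some (Sum.inr ()) := ⟨p, hpq.symm, hp⟩
      refine Or.inr <| Or.inr <| Or.inl ⟨rfl, ?_, q, hpq, hSq, ?_⟩
      · simp [swapVal, hp, hq']
      · simp [swapVal, hSq, h1]
    · refine Or.inr <| Or.inl ⟨rfl, ?_, fun q h1 h2 => hq ⟨q, h1, h2⟩⟩
      simp [swapVal, hp, hq]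

theorem shapeOf_swapVal (s : ℤ) (S : L → Option ZDot) :
    shapeOf (swapVal (Sum.inl s) (Sum.inr ()) S) = shapeOf S := by
  ext p
  simp only [shapeOf, Set.mem_ofPred_eq]
  rcases swapVal_cases s S p with h | h | h | h | h | ⟨x, h⟩ <;> simp [h]

theorem GoodDots.neighbor {S : L → Option ZDot} {e : ℤ} (h : GoodDots S e) {p q : L}
    (hp : p ∈ shapeOf S) (hq : q ∈ shapeOf S) (hpq : p < q)
    (hv : boxVal e S q ≤ boxVal e S p + 1) : Neighbor p q := by
  left
  by_contra hc
  obtain ⟨m, h1, h2⟩ := (not_covBy_iff hpq).1 hc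
  have hm := h.convex.out hp hq ⟨h1.le, h2.le⟩
  have := h.mono p hp m hm h1
  have := h.mono m hm q hq h2
  omega

theorem GoodDots.swapVal {S : L → Option ZDot} {e s : ℤ} (h : GoodDots S e)
    (he : e = 2 * s - 1 ∨ e = 2 * s + 1) :
    GoodDots (swapVal (Sum.inl s) (Sum.inr ()) S) (4 * s - e) := by
  refine ⟨shapeOf_swapVal s S ▸ h.convex, ?_⟩
  rw [shapeOf_swapVal]
  intro p hp q hq hpq
  have hlt := h.mono p hp q hq hpq
  have hnb := h.neighbor hp hq hpq
  rcases swapVal_cases s S p with ⟨h1, -⟩ | ⟨h1, h2, h3⟩ | ⟨h1, h2, h3⟩ | ⟨h1, h2, h3⟩ |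
    ⟨h1, h2, h3⟩ | ⟨x, h3, h1, h2⟩
  · exact absurd h1 hp
  all_goals
    rcases swapVal_cases s S q with ⟨g1, -⟩ | ⟨g1, g2, g3⟩ | ⟨g1, g2, g3⟩ | ⟨g1, g2, g3⟩ |
      ⟨g1, g2, g3⟩ | ⟨y, g3, g1, g2⟩
    · exact absurd g1 hq
  all_goals
    simp only [boxVal, h1, h2, g1, g2, Option.elim_some, Sum.elim_inl, Sum.elim_inr] at hlt hnb ⊢
    first
      | omega
      | exact absurd g1 (h3 q (hnb (by omega)))
      | exact absurd h1 (g3 p (hnb (by omega)).symm)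

end Swap

/-- The row index of a box. -/
def boxRow (p : ℕ × ℕ) : ℤ := p.1

/-- The column index of a box. -/
def boxCol (p : ℕ × ℕ) : ℤ := p.2

theorem Neighbor.right_or_below {p q : ℕ × ℕ} (h : Neighbor p q) (hpq : ¬ q < p) :
    (boxRow q = boxRow p ∧ boxCol q = boxCol p + 1) ∨
      (boxRow q = boxRow p + 1 ∧ boxCol q = boxCol p) := by
  have h : p ⋖ q := h.resolve_right fun h => hpq h.lt
  obtain ⟨a, b⟩ := p
  obtain ⟨c, d⟩ := q
  simp only [Prod.mk_covBy_mk_iff, Order.covBy_iff_add_one_eq] at h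
  simp only [boxRow, boxCol]
  omega

theorem exists_box_between {D : Set (ℕ × ℕ)} (hD : D.OrdConnected) {p q : ℕ × ℕ} (hp : p ∈ D)
    (hq : q ∈ D) {r c : ℤ} (h1 : boxRow p ≤ r) (h2 : r ≤ boxRow q) (h3 : boxCol p ≤ c)
    (h4 : c ≤ boxCol q) : ∃ m ∈ D, boxRow m = r ∧ boxCol m = c := by
  simp only [boxRow, boxCol] at *
  refine ⟨(r.toNat, c.toNat), hD.out hp hq ⟨⟨?_, ?_⟩, ⟨?_, ?_⟩⟩, ?_, ?_⟩ <;> simp only <;> omega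

theorem lt_of_boxRow_le {p q : ℕ × ℕ} (h1 : boxRow p ≤ boxRow q) (h2 : boxCol p ≤ boxCol q)
    (h3 : p ≠ q) : p < q := by
  simp only [boxRow, boxCol, Nat.cast_le] at h1 h2
  exact lt_of_le_of_ne ⟨h1, h2⟩ h3

/-- A swap relates a dotted tableau and its image by `HoleSwap`; `S` is the tableau in which dots
precede `s`, and the two tableaux arise from each other by the swap. -/
theorem holeSwap_of_goodDots {S S' : ℕ × ℕ → Option ZDot} {s : ℤ} (h : GoodDots S (2 * s - 1))
    (h' : GoodDots S' (2 * s + 1))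
    (hS : S' = swapVal (Sum.inl s) (Sum.inr ()) S ∨ S = swapVal (Sum.inl s) (Sum.inr ()) S') :
    HoleSwap boxRow boxCol (shapeOf S) (boxVal (2 * s - 1) S) (boxVal (2 * s + 1) S') (2 * s) := by
  have hsh : shapeOf S' = shapeOf S := by
    rcases hS with rfl | rfl
    · exact shapeOf_swapVal s S
    · exact (shapeOf_swapVal s S').symm
  have hm' := h'.mono
  rw [hsh] at hm'
  have hin : ∀ {p x}, S p = some x → p ∈ shapeOf S := fun hx => by simp [shapeOf, hx]
  have key : ∀ p ∈ shapeOf S, (∃ x, x ≠ s ∧ S p = some (Sum.inl x) ∧ S' p = some (Sum.inl x)) ∨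
      (S p = some (Sum.inr ()) ∧ S' p = some (Sum.inr ())) ∨
      (S p = some (Sum.inl s) ∧ S' p = some (Sum.inl s)) ∨
      (S p = some (Sum.inr ()) ∧ S' p = some (Sum.inl s) ∧
        ∃ q, Neighbor p q ∧ S q = some (Sum.inl s) ∧ S' q = some (Sum.inr ())) ∨
      (S p = some (Sum.inl s) ∧ S' p = some (Sum.inr ()) ∧
        ∃ q, Neighbor p q ∧ S q = some (Sum.inr ()) ∧ S' q = some (Sum.inl s)) := by
    intro p hp
    rcases hS with rfl | rfl
    · rcases swapVal_cases s S p with h | h | h | h | h | h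
      · exact absurd h.1 hp
      · tauto
      · exact Or.inr <| Or.inr <| Or.inr <| Or.inl h
      · tauto
      · tauto
      · obtain ⟨x, h⟩ := h
        exact Or.inl ⟨x, h⟩
    · rcases swapVal_cases s S' p with h | h | h | h | ⟨h1, h2, q, h3, h4, h5⟩ | ⟨x, h⟩
      · exact absurd h.2 hp
      · tauto
      · obtain ⟨h1, h2, q, h3, h4, h5⟩ := h
        exact Or.inr <| Or.inr <| Or.inr <| Or.inr ⟨h2, h1, q, h3, h5, h4⟩
      · tauto
      · exact Or.inr <| Or.inr <| Or.inr <| Or.inl ⟨h2, h1, q, h3, h5, h4⟩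
      · exact Or.inl ⟨x, h.1, h.2.2, h.2.1⟩
  refine ⟨?_, ?_, ?_, ?_, ?_, ?_, ?_⟩
  · intro p q h1 h2
    simp only [boxRow, boxCol, Nat.cast_inj] at h1 h2
    exact Prod.ext h1 h2
  · exact fun p hp q hq r c h1 h2 h3 h4 => exists_box_between h.convex hp hq h1 h2 h3 h4
  · exact fun p hp q hq h1 h2 h3 => h.mono p hp q hq (lt_of_boxRow_le h1 h2 h3)
  · exact fun p hp q hq h1 h2 h3 => hm' p hp q hq (lt_of_boxRow_le h1 h2 h3)
  · intro p hp
    rcases key p hp with ⟨x, h0, h1, h2⟩ | ⟨h1, h2⟩ | ⟨h1, h2⟩ | ⟨h1, h2, -⟩ | ⟨h1, h2, -⟩ <;>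
      simp only [boxVal, h1, h2, Option.elim_some, Sum.elim_inl, Sum.elim_inr, true_and, true_or,
        or_true]
    omega
  · intro p hp hF hG
    rcases key p hp with ⟨x, h0, h1, h2⟩ | ⟨h1, h2⟩ | ⟨h1, h2⟩ | ⟨h1, h2, q, h3, h4, h5⟩ |
      ⟨h1, h2, -⟩
    case inr.inr.inr.inl =>
      refine ⟨q, hin h4, boxVal_inl h4, boxVal_inr h5, h3.right_or_below fun hlt => ?_⟩
      have := h.mono q (hin h4) p hp hlt
      rw [boxVal_inl h4] at this
      omega
    all_goals
      simp only [boxVal, h1, h2, Option.elim_some, Sum.elim_inl, Sum.elim_inr] at hF hG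
      omega
  · intro p hp hF hG
    rcases key p hp with ⟨x, h0, h1, h2⟩ | ⟨h1, h2⟩ | ⟨h1, h2⟩ | ⟨h1, h2, -⟩ |
      ⟨h1, h2, q, h3, h4, h5⟩
    case inr.inr.inr.inr =>
      refine ⟨q, hin h4, boxVal_inr h4, boxVal_inl h5, h3.symm.right_or_below fun hlt => ?_⟩
      have := h.mono p hp q (hin h4) hlt
      rw [boxVal_inr h4] at this
      omega
    all_goals
      simp only [boxVal, h1, h2, Option.elim_some, Sum.elim_inl, Sum.elim_inr] at hF hG
      omega

section Slide

/-- There is a north-east chain of length `n` among the boxes of `T`. -/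
def HasNEChain {L : Type} (row col : L → ℤ) (T : L → Option ℤ) (n : ℕ) : Prop :=
  ∃ l : List L, l.length = n ∧ (∀ p ∈ l, T p ≠ none) ∧
    l.IsChain (NELt row col fun p => (T p).getD 0)

theorem restrictInt_eq_some {L : Type} {S : L → Option ZDot} {p : L} {x : ℤ} :
    restrictInt S p = some x ↔ S p = some (Sum.inl x) := by
  rcases h : S p with - | y | ⟨⟩ <;> simp [restrictInt, h]

theorem boxVal_eq_of_restrictInt_ne {L : Type} {S : L → Option ZDot} {p : L} (e : ℤ)
    (h : restrictInt S p ≠ none) :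
    p ∈ shapeOf S ∧ boxVal e S p = 2 * (restrictInt S p).getD 0 := by
  obtain ⟨x, hx⟩ := Option.ne_none_iff_exists'.1 h
  rw [hx]
  rw [restrictInt_eq_some] at hx
  exact ⟨by simp [shapeOf, hx], boxVal_inl hx⟩

theorem restrictInt_ne_of_boxVal_ne {L : Type} {S : L → Option ZDot} {p : L} {e : ℤ}
    (hp : p ∈ shapeOf S) (h : boxVal e S p ≠ e) : restrictInt S p ≠ none := by
  rcases hS : S p with - | y | ⟨⟩
  · exact absurd hS hp
  · rw [restrictInt_eq_some.2 hS]
    simp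
  · exact absurd (boxVal_inr hS) h

theorem isChain_boxVal_iff {L : Type} {row col : L → ℤ} {S : L → Option ZDot} {l : List L} (e : ℤ)
    (h : ∀ p ∈ l, restrictInt S p ≠ none) :
    l.IsChain (NELt row col (boxVal e S)) ↔
      l.IsChain (NELt row col fun p => (restrictInt S p).getD 0) := by
  have key : ∀ p ∈ l, ∀ q ∈ l, NELt row col (boxVal e S) p q ↔
      NELt row col (fun p => (restrictInt S p).getD 0) p q := fun p hp q hq => by
    rw [NELt, NELt, (boxVal_eq_of_restrictInt_ne e (h p hp)).2,
      (boxVal_eq_of_restrictInt_ne e (h q hq)).2]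
    simp
  exact ⟨fun hl => hl.imp_of_mem_imp fun p q hp hq => (key p hp q hq).1,
    fun hl => hl.imp_of_mem_imp fun p q hp hq => (key p hp q hq).2⟩

theorem hasDropChain_iff_hasNEChain {L : Type} {row col : L → ℤ} {S : L → Option ZDot} {e : ℤ}
    {n : ℕ} (hS : (∀ p x, S p = some (Sum.inl x) → e < 2 * x) ∨
      ∀ p x, S p = some (Sum.inl x) → 2 * x < e) :
    HasDropChain row col (shapeOf S) (boxVal e S) e n ↔ HasNEChain row col (restrictInt S) n := by
  have hval : ∀ {p}, restrictInt S p ≠ none → ∃ x, S p = some (Sum.inl x) ∧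
      boxVal e S p = 2 * x := fun h => by
    obtain ⟨x, hx⟩ := Option.ne_none_iff_exists'.1 h
    rw [restrictInt_eq_some] at hx
    exact ⟨x, hx, boxVal_inl hx⟩
  constructor
  · rintro ⟨l₁, l₂, hn, h1, h2, c1, c2, -⟩
    have g1 : ∀ p ∈ l₁, restrictInt S p ≠ none := fun p hp =>
      restrictInt_ne_of_boxVal_ne (h1 p hp).1 (h1 p hp).2.ne
    have g2 : ∀ p ∈ l₂, restrictInt S p ≠ none := fun p hp =>
      restrictInt_ne_of_boxVal_ne (h2 p hp).1 (h2 p hp).2.ne'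
    rcases hS with hS | hS
    · have : l₁ = [] := List.eq_nil_iff_forall_not_mem.2 fun p hp => by
        obtain ⟨x, hx, hv⟩ := hval (g1 p hp)
        have := hS p x hx
        have := (h1 p hp).2
        omega
      subst this
      exact ⟨l₂, by simpa using hn, g2, (isChain_boxVal_iff e g2).1 c2⟩
    · have : l₂ = [] := List.eq_nil_iff_forall_not_mem.2 fun p hp => by
        obtain ⟨x, hx, hv⟩ := hval (g2 p hp)
        have := hS p x hx
        have := (h2 p hp).2
        omega
      subst this
      exact ⟨l₁, by simpa using hn, g1, (isChain_boxVal_iff e g1).1 c1⟩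
  · rintro ⟨l, hn, g, c⟩
    rw [← isChain_boxVal_iff e g] at c
    rcases hS with hS | hS
    · refine ⟨[], l, by simpa using hn, by simp, fun p hp => ?_, by simp, c, by simp⟩
      obtain ⟨x, hx, hv⟩ := hval (g p hp)
      have := hS p x hx
      exact ⟨by simp [shapeOf, hx], by omega⟩
    · refine ⟨l, [], by simpa using hn, fun p hp => ?_, by simp, c, by simp, by simp⟩
      obtain ⟨x, hx, hv⟩ := hval (g p hp)
      have := hS p x hx
      exact ⟨by simp [shapeOf, hx], by omega⟩

theorem GoodDots.increasing {L : Type} [PartialOrder L] {S : L → Option ZDot} {e : ℤ}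
    (h : GoodDots S e) : Increasing (restrictInt S) := by
  intro p q hpq x y hx hy
  rw [restrictInt_eq_some] at hx hy
  have := h.mono p (by simp [shapeOf, hx]) q (by simp [shapeOf, hy]) hpq
  rw [boxVal_inl hx, boxVal_inl hy] at this
  omega

theorem exists_inl_of_swapVal {L : Type} [PartialOrder L] {S : L → Option ZDot} {s x : ℤ} {p : L}
    (h : swapVal (Sum.inl s) (Sum.inr ()) S p = some (Sum.inl x)) :
    ∃ q, S q = some (Sum.inl x) := by
  rcases swapVal_cases s S p with ⟨-, h1⟩ | ⟨-, h1, -⟩ | ⟨-, h1, q, -, h2, -⟩ | ⟨h2, h1, -⟩ |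
    ⟨-, h1, -⟩ | ⟨y, -, h2, h1⟩
  all_goals rw [h1] at h
  · simp at h
  · simp at h
  · exact ⟨q, h2.trans h⟩
  · exact ⟨p, h2.trans h⟩
  · simp at h
  · exact ⟨p, h2.trans h⟩

/-- The tableaux `T` and `T'` have north-east chains and south-west chains of the same lengths. -/
def SameChains (T T' : ℕ × ℕ → Option ℤ) : Prop :=
  ∀ n, (HasNEChain boxRow boxCol T n ↔ HasNEChain boxRow boxCol T' n) ∧
    (HasNEChain boxCol boxRow T n ↔ HasNEChain boxCol boxRow T' n)

/-- The chain invariants of two dotted tableaux, with values `e` and `e'` of the dots, agree. -/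
def SameDropChains (S : ℕ × ℕ → Option ZDot) (e : ℤ) (S' : ℕ × ℕ → Option ZDot) (e' : ℤ) : Prop :=
  ∀ n, (HasDropChain boxRow boxCol (shapeOf S) (boxVal e S) e n ↔
      HasDropChain boxRow boxCol (shapeOf S') (boxVal e' S') e' n) ∧
    (HasDropChain boxCol boxRow (shapeOf S) (boxVal e S) e n ↔
      HasDropChain boxCol boxRow (shapeOf S') (boxVal e' S') e' n)

theorem sameDropChains_swapVal {S : ℕ × ℕ → Option ZDot} {e s : ℤ} (h : GoodDots S e)
    (he : e = 2 * s - 1 ∨ e = 2 * s + 1) :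
    SameDropChains S e (swapVal (Sum.inl s) (Sum.inr ()) S) (4 * s - e) := by
  have h' := h.swapVal he
  rcases he with rfl | rfl
  · rw [show 4 * s - (2 * s - 1) = 2 * s + 1 by ring] at h' ⊢
    have H := holeSwap_of_goodDots h h' (Or.inl rfl)
    rw [SameDropChains, shapeOf_swapVal]
    exact fun n => ⟨H.hasDropChain_iff, H.transpose.hasDropChain_iff⟩
  · rw [show 4 * s - (2 * s + 1) = 2 * s - 1 by ring] at h' ⊢
    have H := holeSwap_of_goodDots h' h (Or.inr rfl)
    rw [shapeOf_swapVal] at H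
    rw [SameDropChains, shapeOf_swapVal]
    exact fun n => ⟨H.hasDropChain_iff.symm, H.transpose.hasDropChain_iff.symm⟩

theorem SameDropChains.trans {S S' S'' : ℕ × ℕ → Option ZDot} {e e' e'' : ℤ}
    (h : SameDropChains S e S' e') (h' : SameDropChains S' e' S'' e'') :
    SameDropChains S e S'' e'' :=
  fun n => ⟨(h n).1.trans (h' n).1, (h n).2.trans (h' n).2⟩

theorem swapUp_invariant {S : ℕ × ℕ → Option ZDot} {a : ℤ} (h : GoodDots S (2 * a - 1)) (k : ℕ) :
    GoodDots (swapUp a k S) (2 * (a + k) - 1) ∧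
      (∀ p x, swapUp a k S p = some (Sum.inl x) → ∃ q, S q = some (Sum.inl x)) ∧
      SameDropChains S (2 * a - 1) (swapUp a k S) (2 * (a + k) - 1) := by
  induction k with
  | zero =>
    rw [show 2 * (a + (0 : ℕ)) - 1 = 2 * a - 1 by simp]
    exact ⟨h, fun p x hx => ⟨p, hx⟩, fun n => ⟨Iff.rfl, Iff.rfl⟩⟩
  | succ k ih =>
    obtain ⟨h1, h2, h3⟩ := ih
    have g1 := h1.swapVal (Or.inl rfl)
    have g3 := h3.trans (sameDropChains_swapVal h1 (Or.inl rfl))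
    rw [show 4 * (a + k) - (2 * (a + k) - 1) = 2 * (a + (k + 1 : ℕ)) - 1 by push_cast; ring]
      at g1 g3
    refine ⟨g1, fun p x hx => ?_, g3⟩
    obtain ⟨q, hq⟩ := exists_inl_of_swapVal hx
    exact h2 q x hq

theorem swapDown_invariant {S : ℕ × ℕ → Option ZDot} {b : ℤ} (h : GoodDots S (2 * b + 1))
    (k : ℕ) :
    GoodDots (swapDown b k S) (2 * (b - k) + 1) ∧
      (∀ p x, swapDown b k S p = some (Sum.inl x) → ∃ q, S q = some (Sum.inl x)) ∧
      SameDropChains S (2 * b + 1) (swapDown b k S) (2 * (b - k) + 1) := by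
  induction k with
  | zero =>
    rw [show 2 * (b - (0 : ℕ)) + 1 = 2 * b + 1 by simp]
    exact ⟨h, fun p x hx => ⟨p, hx⟩, fun n => ⟨Iff.rfl, Iff.rfl⟩⟩
  | succ k ih =>
    obtain ⟨h1, h2, h3⟩ := ih
    have g1 := h1.swapVal (Or.inr rfl)
    have g3 := h3.trans (sameDropChains_swapVal h1 (Or.inr rfl))
    rw [show 4 * (b - k) - (2 * (b - k) + 1) = 2 * (b - (k + 1 : ℕ)) + 1 by push_cast; ring]
      at g1 g3
    refine ⟨g1, fun p x hx => ?_, g3⟩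
    obtain ⟨q, hq⟩ := exists_inl_of_swapVal hx
    exact h2 q x hq

theorem SameDropChains.sameChains {S S' : ℕ × ℕ → Option ZDot} {e e' : ℤ}
    (h : SameDropChains S e S' e')
    (hS : (∀ p x, S p = some (Sum.inl x) → e < 2 * x) ∨
      ∀ p x, S p = some (Sum.inl x) → 2 * x < e)
    (hS' : (∀ p x, S' p = some (Sum.inl x) → e' < 2 * x) ∨
      ∀ p x, S' p = some (Sum.inl x) → 2 * x < e') :
    SameChains (restrictInt S) (restrictInt S') := by
  intro n
  simp only [← hasDropChain_iff_hasNEChain hS, ← hasDropChain_iff_hasNEChain hS']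
  exact h n

theorem addDots_cases {L : Type} (C : Finset L) (T : L → Option ℤ) (p : L) :
    (p ∈ C ∧ addDots C (toDotted T) p = some (Sum.inr ())) ∨
      (p ∉ C ∧ T p = none ∧ addDots C (toDotted T) p = none) ∨
      ∃ x, p ∉ C ∧ T p = some x ∧ addDots C (toDotted T) p = some (Sum.inl x) := by
  by_cases hp : p ∈ C
  · simp [addDots, hp]
  · rcases hT : T p with - | x <;> simp [addDots, toDotted, hp, hT]

theorem addDots_eq_inl {L : Type} {C : Finset L} {T : L → Option ℤ} {p : L} {x : ℤ}
    (h : addDots C (toDotted T) p = some (Sum.inl x)) : T p = some x := by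
  rcases addDots_cases C T p with h' | h' | ⟨y, h'⟩ <;> simp_all

theorem shapeOf_addDots {L : Type} (C : Finset L) (T : L → Option ℤ) :
    shapeOf (addDots C (toDotted T)) = ↑C ∪ shapeOf T := by
  ext p
  rcases addDots_cases C T p with h | h | ⟨y, h⟩ <;> simp [shapeOf, h]

theorem restrictInt_addDots {L : Type} {C : Finset L} {T : L → Option ℤ}
    (h : ∀ p ∈ C, p ∉ shapeOf T) : restrictInt (addDots C (toDotted T)) = T := by
  ext p x
  rw [restrictInt_eq_some]
  rcases addDots_cases C T p with h' | h' | ⟨y, h'⟩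
  · have : T p = none := by simpa [shapeOf] using h p h'.1
    simp [h', this]
  all_goals simp [h']

theorem goodDots_of_forward {L : Type} [PartialOrder L] {T : L → Option ℤ} {lam nu C : Finset L}
    {a b : ℤ} (hT : Increasing T) (hskew : IsSkewPair lam nu)
    (hsh : shapeOf T = (nu : Set L) \ (lam : Set L)) (hv : ValuesIn T a b)
    (hC : ∀ c ∈ C, c ∈ lam ∧ ∀ d ∈ lam, ¬ c < d) :
    GoodDots (addDots C (toDotted T)) (2 * a - 1) := by
  obtain ⟨hlam, hnu, hsub⟩ := hskew
  constructor
  · rw [shapeOf_addDots, hsh]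
    refine ⟨fun x hx y hy m ⟨h1, h2⟩ => ?_⟩
    have hm : m ∈ nu := hnu y (by
      rcases hy with hy | hy
      · exact hsub (hC y hy).1
      · exact hy.1) m h2
    by_cases hml : m ∈ lam
    · have hxl := hlam m hml x h1
      have hxC := hx.resolve_right fun hx => hx.2 hxl
      obtain rfl : x = m := by_contra fun hne => (hC x hxC).2 m hml (lt_of_le_of_ne h1 hne)
      exact Or.inl hxC
    · exact Or.inr ⟨hm, hml⟩
  · intro p hp q hq hpq
    have hTlam : ∀ {r x}, T r = some x → r ∉ lam := fun {r x} hr => by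
      have : r ∈ shapeOf T := by simp [shapeOf, hr]
      rw [hsh] at this
      exact this.2
    rcases addDots_cases C T q with ⟨hqC, hq'⟩ | ⟨-, -, hq'⟩ | ⟨y, -, hy, hq'⟩
    · rcases addDots_cases C T p with ⟨hpC, hp'⟩ | ⟨-, -, hp'⟩ | ⟨x, -, hx, hp'⟩
      · exact absurd hpq ((hC p hpC).2 q (hC q hqC).1)
      · exact absurd hp' hp
      · exact absurd (hlam q (hC q hqC).1 p hpq.le) (hTlam hx)
    · exact absurd hq' hq
    · rw [boxVal_inl hq']
      have := (hv q y hy).1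
      rcases addDots_cases C T p with ⟨-, hp'⟩ | ⟨-, -, hp'⟩ | ⟨x, -, hx, hp'⟩
      · rw [boxVal_inr hp']
        omega
      · exact absurd hp' hp
      · rw [boxVal_inl hp']
        have := hT p q hpq x y hx hy
        omega

theorem goodDots_of_reverse {L : Type} [PartialOrder L] {T : L → Option ℤ} {lam nu C : Finset L}
    {a b : ℤ} (hT : Increasing T) (hskew : IsSkewPair lam nu)
    (hsh : shapeOf T = (nu : Set L) \ (lam : Set L)) (hv : ValuesIn T a b)
    (hC : ∀ c ∈ C, c ∉ nu ∧ ∀ d : L, d ∉ nu → ¬ d < c) :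
    GoodDots (addDots C (toDotted T)) (2 * b + 1) := by
  obtain ⟨hlam, hnu, hsub⟩ := hskew
  constructor
  · rw [shapeOf_addDots, hsh]
    refine ⟨fun x hx y hy m ⟨h1, h2⟩ => ?_⟩
    have hm : m ∉ lam := fun hm => by
      have hxl := hlam m hm x h1
      rcases hx with hx | hx
      · exact (hC x hx).1 (hsub hxl)
      · exact hx.2 hxl
    by_cases hmn : m ∈ nu
    · exact Or.inr ⟨hmn, hm⟩
    · have hyC := hy.resolve_right fun hy => hmn (hnu y hy.1 m h2)
      obtain rfl : m = y := by_contra fun hne => (hC y hyC).2 m hmn (lt_of_le_of_ne h2 hne)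
      exact Or.inl hyC
  · intro p hp q hq hpq
    have hTnu : ∀ {r x}, T r = some x → r ∈ nu := fun {r x} hr => by
      have : r ∈ shapeOf T := by simp [shapeOf, hr]
      rw [hsh] at this
      exact this.1
    rcases addDots_cases C T p with ⟨hpC, hp'⟩ | ⟨-, -, hp'⟩ | ⟨x, -, hx, hp'⟩
    · rcases addDots_cases C T q with ⟨hqC, hq'⟩ | ⟨-, -, hq'⟩ | ⟨y, -, hy, hq'⟩
      · exact absurd hpq ((hC q hqC).2 p (hC p hpC).1)
      · exact absurd hq' hq
      · exact absurd (hnu q (hTnu hy) p hpq.le) (hC p hpC).1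
    · exact absurd hp' hp
    · rw [boxVal_inl hp']
      have := (hv p x hx).2
      rcases addDots_cases C T q with ⟨-, hq'⟩ | ⟨-, -, hq'⟩ | ⟨y, -, hy, hq'⟩
      · rw [boxVal_inr hq']
        omega
      · exact absurd hq' hq
      · rw [boxVal_inl hq']
        have := hT p q hpq x y hx hy
        omega

theorem IsForwardSlide.sameChains {T T' : ℕ × ℕ → Option ℤ} (hT : Increasing T)
    (h : IsForwardSlide T T') : Increasing T' ∧ SameChains T T' := by
  obtain ⟨lam, nu, C, a, b, hskew, hsh, hv, hC, rfl⟩ := h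
  obtain ⟨h1, h2, h3⟩ := swapUp_invariant (goodDots_of_forward hT hskew hsh hv hC)
    (b - a + 1).toNat
  refine ⟨h1.increasing, ?_⟩
  have := h3.sameChains (Or.inl fun p x hx => ?_) (Or.inr fun p x hx => ?_)
  · rwa [restrictInt_addDots] at this
    intro p hp hp'
    rw [hsh] at hp'
    exact hp'.2 (hC p hp).1
  · have := hv p x (addDots_eq_inl hx)
    omega
  · obtain ⟨q, hq⟩ := h2 p x hx
    have := hv q x (addDots_eq_inl hq)
    omega

theorem IsReverseSlide.sameChains {T T' : ℕ × ℕ → Option ℤ} (hT : Increasing T)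
    (h : IsReverseSlide T T') : Increasing T' ∧ SameChains T T' := by
  obtain ⟨lam, nu, C, a, b, hskew, hsh, hv, hC, rfl⟩ := h
  obtain ⟨h1, h2, h3⟩ := swapDown_invariant (goodDots_of_reverse hT hskew hsh hv hC)
    (b - a + 1).toNat
  refine ⟨h1.increasing, ?_⟩
  have := h3.sameChains (Or.inr fun p x hx => ?_) (Or.inl fun p x hx => ?_)
  · rwa [restrictInt_addDots] at this
    intro p hp hp'
    rw [hsh] at hp'
    exact (hC p hp).1 hp'.1
  · have := hv p x (addDots_eq_inl hx)
    omega
  · obtain ⟨q, hq⟩ := h2 p x hx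
    have := hv q x (addDots_eq_inl hq)
    omega

theorem JdtEquiv.sameChains {T T' : ℕ × ℕ → Option ℤ} (hT : Increasing T) (h : JdtEquiv T T') :
    Increasing T' ∧ SameChains T T' := by
  induction h with
  | refl => exact ⟨hT, fun n => ⟨Iff.rfl, Iff.rfl⟩⟩
  | tail _ h ih =>
    obtain ⟨h1, h2⟩ := ih
    obtain ⟨g1, g2⟩ := h.elim (·.sameChains h1) (·.sameChains h1)
    exact ⟨g1, fun n => ⟨(h2 n).1.trans (g2 n).1, (h2 n).2.trans (g2 n).2⟩⟩

end Slide

section RowWord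

/-- The box `p` is read before the box `q` in the row word. -/
def ReadBefore (p q : ℕ × ℕ) : Prop := q.1 < p.1 ∨ (q.1 = p.1 ∧ p.2 < q.2)

/-- The boxes of the rectangle `[0, rmax] × [0, cmax]` in reading order. -/
def readingBoxes (rmax cmax : ℕ) : List (ℕ × ℕ) :=
  (List.range (rmax + 1)).reverse.flatMap fun r => (List.range (cmax + 1)).map fun c => (r, c)

theorem rowWord_eq_filterMap (T : ℕ × ℕ → Option ℤ) (rmax cmax : ℕ) :
    rowWord T rmax cmax = (readingBoxes rmax cmax).filterMap T := by
  simp [rowWord, readingBoxes, List.filterMap_flatMap, List.filterMap_map]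

theorem mem_readingBoxes {rmax cmax : ℕ} {p : ℕ × ℕ} :
    p ∈ readingBoxes rmax cmax ↔ p.1 ≤ rmax ∧ p.2 ≤ cmax := by
  obtain ⟨r, c⟩ := p
  simp [readingBoxes]

theorem pairwise_readingBoxes (rmax cmax : ℕ) :
    (readingBoxes rmax cmax).Pairwise ReadBefore := by
  rw [readingBoxes, List.pairwise_flatMap]
  constructor
  · intro r _
    rw [List.pairwise_map]
    exact List.pairwise_lt_range.imp fun h => Or.inr ⟨rfl, h⟩
  · rw [List.pairwise_reverse]
    refine List.pairwise_lt_range.imp fun h => ?_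
    intro x hx y hy
    simp only [List.mem_map] at hx hy
    obtain ⟨_, _, rfl⟩ := hx
    obtain ⟨_, _, rfl⟩ := hy
    exact Or.inl h

theorem exists_sublist_rowWord_iff {T : ℕ × ℕ → Option ℤ} {rmax cmax : ℕ}
    (hb : BoundedBy T rmax cmax) (R : ℤ → ℤ → Prop) (n : ℕ) :
    (∃ s : List ℤ, s.Sublist (rowWord T rmax cmax) ∧ s.IsChain R ∧ s.length = n) ↔
      ∃ l : List (ℕ × ℕ), l.length = n ∧ (∀ p ∈ l, T p ≠ none) ∧
        l.IsChain fun p q => ReadBefore p q ∧ R ((T p).getD 0) ((T q).getD 0) := by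
  have hmap : ∀ l : List (ℕ × ℕ), (∀ p ∈ l, T p ≠ none) →
      l.filterMap T = l.map fun p => (T p).getD 0 := fun l hl => by
    rw [← List.filterMap_eq_map]
    refine List.filterMap_congr fun p hp => ?_
    obtain ⟨x, hx⟩ := Option.ne_none_iff_exists'.1 (hl p hp)
    simp [hx]
  have : IsTrans (ℕ × ℕ) ReadBefore := ⟨fun p q r h1 h2 => by
    unfold ReadBefore at *
    omega⟩
  have : Std.Antisymm ReadBefore := ⟨fun p q h1 h2 => by
    unfold ReadBefore at *
    omega⟩
  have : Std.Irrefl ReadBefore := ⟨fun p h => by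
    unfold ReadBefore at h
    omega⟩
  constructor
  · rintro ⟨s, hs, hc, rfl⟩
    rw [rowWord_eq_filterMap, List.sublist_filterMap_iff] at hs
    obtain ⟨l, hl, rfl⟩ := hs
    have hl' : (l.filter fun p => (T p).isSome).filterMap T = l.filterMap T := by
      rw [List.filterMap_filter]
      refine List.filterMap_congr fun p _ => ?_
      cases h : T p <;> simp
    have hmem : ∀ p ∈ l.filter fun p => (T p).isSome, T p ≠ none := by
      simp [Option.isSome_iff_ne_none]
    have hpw := ((pairwise_readingBoxes rmax cmax).sublist hl).filter fun p => (T p).isSome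
    rw [← hl', hmap _ hmem] at hc ⊢
    refine ⟨_, by simp, hmem, ?_⟩
    rw [List.isChain_map] at hc
    exact List.isChain_iff_getElem.2 fun i hi =>
      ⟨List.isChain_iff_getElem.1 hpw.isChain i hi, List.isChain_iff_getElem.1 hc i hi⟩
  · rintro ⟨l, rfl, hl, hc⟩
    have hpw : l.Pairwise ReadBefore := (hc.imp fun p q h => h.1).pairwise
    refine ⟨l.map fun p => (T p).getD 0, ?_, ?_, by simp⟩
    · rw [rowWord_eq_filterMap, ← hmap l hl]
      refine List.Sublist.filterMap T (List.sublist_of_subperm_of_pairwise ?_ hpw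
        (pairwise_readingBoxes rmax cmax))
      refine List.Nodup.subperm hpw.nodup fun p hp => ?_
      exact mem_readingBoxes.2 (hb p (hl p hp))
    · rw [List.isChain_map]
      exact hc.imp fun p q h => h.2

theorem Increasing.getD_lt {L : Type} [PartialOrder L] {T : L → Option ℤ} (hT : Increasing T)
    {p q : L} (hp : T p ≠ none) (hq : T q ≠ none) (hpq : p < q) :
    (T p).getD 0 < (T q).getD 0 := by
  obtain ⟨x, hx⟩ := Option.ne_none_iff_exists'.1 hp
  obtain ⟨y, hy⟩ := Option.ne_none_iff_exists'.1 hq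
  simpa [hx, hy] using hT p q hpq x y hx hy

theorem exists_increasing_sublist_iff {T : ℕ × ℕ → Option ℤ} (hT : Increasing T) {rmax cmax : ℕ}
    (hb : BoundedBy T rmax cmax) (n : ℕ) :
    (∃ s : List ℤ, s.Sublist (rowWord T rmax cmax) ∧ s.IsChain (· < ·) ∧ s.length = n) ↔
      HasNEChain boxRow boxCol T n := by
  rw [exists_sublist_rowWord_iff hb]
  refine exists_congr fun l => and_congr_right fun _ => and_congr_right fun hl => ?_
  refine ⟨fun hc => hc.imp_of_mem_imp fun p q hp hq h => ?_,
    fun hc => hc.imp_of_mem_imp fun p q hp hq h => ?_⟩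
  · obtain ⟨h1, h2⟩ := h
    refine ⟨h2, ?_⟩
    by_contra hcon
    refine h2.not_gt (hT.getD_lt (hl q hq) (hl p hp) ?_)
    simp only [ReadBefore, boxRow, boxCol] at h1 hcon
    refine lt_of_le_of_ne ⟨by omega, by omega⟩ fun heq => ?_
    subst heq
    omega
  · obtain ⟨h1, h2, h3⟩ := h
    simp only [ReadBefore, boxRow, boxCol] at h2 h3 ⊢
    exact ⟨by omega, h1⟩

theorem HasSkewShape.ordConnected {L : Type} [PartialOrder L] {T : L → Option ℤ}
    (h : HasSkewShape T) : (shapeOf T).OrdConnected := by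
  obtain ⟨lam, nu, ⟨hlam, hnu, -⟩, hsh⟩ := h
  rw [hsh]
  exact ⟨fun x hx y hy m hm => ⟨hnu y hy.1 m hm.2, fun hml => hx.2 (hlam m hml x hm.1)⟩⟩

/-- A chain of boxes going down can be pushed to the left so that it goes south-west. -/
theorem exists_southWest_chain {T : ℕ × ℕ → Option ℤ} (hT : IncreasingSkewTableau T)
    (l : List (ℕ × ℕ)) (p p₀ : ℕ × ℕ) (hl : ∀ q ∈ l, T q ≠ none) (hp₀ : T p₀ ≠ none)
    (hc : (p :: l).IsChain fun p q => p.1 < q.1 ∧ (T p).getD 0 < (T q).getD 0)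
    (h1 : p₀.1 = p.1) (h2 : (T p₀).getD 0 ≤ (T p).getD 0) :
    ∃ l' : List (ℕ × ℕ), l'.length = l.length ∧ (∀ q ∈ l', T q ≠ none) ∧
      (p₀ :: l').IsChain (NELt boxCol boxRow fun p => (T p).getD 0) := by
  induction l generalizing p p₀ with
  | nil => exact ⟨[], rfl, by simp, by simp⟩
  | cons q l ih =>
    rw [List.isChain_cons_cons] at hc
    obtain ⟨⟨h3, h4⟩, hc⟩ := hc
    have hq : T q ≠ none := hl q (by simp)
    obtain ⟨q₀, hq₀, g1, g2, g3, g4⟩ : ∃ q₀, T q₀ ≠ none ∧ q₀.1 = q.1 ∧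
        (T q₀).getD 0 ≤ (T q).getD 0 ∧ (T p₀).getD 0 < (T q₀).getD 0 ∧ q₀.2 ≤ p₀.2 := by
      by_cases hcol : q.2 ≤ p₀.2
      · exact ⟨q, hq, rfl, le_rfl, by omega, hcol⟩
      · have hlt₁ : p₀ < (q.1, p₀.2) := Prod.lt_iff.2 (Or.inl ⟨by simp only; omega, le_rfl⟩)
        have hlt₂ : (q.1, p₀.2) < q := Prod.lt_iff.2 (Or.inr ⟨le_rfl, by simp only; omega⟩)
        have hmem : T (q.1, p₀.2) ≠ none :=
          hT.1.ordConnected.out hp₀ hq ⟨hlt₁.le, hlt₂.le⟩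
        exact ⟨_, hmem, rfl, (hT.2.getD_lt hmem hq hlt₂).le, hT.2.getD_lt hp₀ hmem hlt₁, le_rfl⟩
    obtain ⟨l', e1, e2, e3⟩ := ih q q₀ (fun r hr => hl r (by simp [hr])) hq₀ hc g1 g2
    refine ⟨q₀ :: l', by simp [e1], List.forall_mem_cons.2 ⟨hq₀, e2⟩, ?_⟩
    rw [List.isChain_cons_cons]
    refine ⟨⟨g3, ?_, ?_⟩, e3⟩ <;> simp only [boxRow, boxCol] <;> omega

theorem exists_decreasing_sublist_iff {T : ℕ × ℕ → Option ℤ} (hT : IncreasingSkewTableau T)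
    {rmax cmax : ℕ} (hb : BoundedBy T rmax cmax) (n : ℕ) :
    (∃ s : List ℤ, s.Sublist (rowWord T rmax cmax) ∧ s.IsChain (· > ·) ∧ s.length = n) ↔
      HasNEChain boxCol boxRow T n := by
  rw [exists_sublist_rowWord_iff hb]
  constructor
  · rintro ⟨l, rfl, hl, hc⟩
    rw [← List.isChain_reverse] at hc
    have hl' : ∀ p ∈ l.reverse, T p ≠ none := by simpa using hl
    have hc' : l.reverse.IsChain fun p q => p.1 < q.1 ∧ (T p).getD 0 < (T q).getD 0 := by
      refine hc.imp_of_mem_imp fun p q hp hq h => ⟨?_, h.2⟩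
      refine h.1.resolve_right fun h' => ?_
      have := hT.2.getD_lt (hl' q hq) (hl' p hp) (Prod.lt_iff.2 (Or.inr ⟨h'.1.ge, h'.2⟩))
      exact this.not_gt h.2
    rw [← l.length_reverse]
    generalize l.reverse = m at hl' hc'
    cases m with
    | nil => exact ⟨[], rfl, by simp, by simp⟩
    | cons p m =>
      obtain ⟨l', e1, e2, e3⟩ := exists_southWest_chain hT m p p (fun q hq => hl' q (by simp [hq]))
        (hl' p (by simp)) hc' rfl le_rfl
      exact ⟨p :: l', by simp [e1], List.forall_mem_cons.2 ⟨hl' p (by simp), e2⟩, e3⟩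
  · rintro ⟨l, rfl, hl, hc⟩
    refine ⟨l.reverse, by simp, by simpa using hl, ?_⟩
    rw [List.isChain_reverse]
    refine hc.imp fun p q ⟨h1, h2, h3⟩ => ⟨Or.inl ?_, h1⟩
    simpa [boxRow] using h2

end RowWord

theorem lis_lds_jdt_invariant
    (T T' : ℕ × ℕ → Option ℤ)
    (hT : IncreasingSkewTableau T) (hT' : IncreasingSkewTableau T')
    (h : JdtEquiv T T')
    (rm cm rm' cm' : ℕ) (hb : BoundedBy T rm cm) (hb' : BoundedBy T' rm' cm') :
    lisOf (rowWord T rm cm) = lisOf (rowWord T' rm' cm') ∧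
    ldsOf (rowWord T rm cm) = ldsOf (rowWord T' rm' cm') := by
  obtain ⟨-, hs⟩ := h.sameChains hT.2
  constructor
  · refine congrArg sSup (Set.ext fun n => ?_)
    exact (exists_increasing_sublist_iff hT.2 hb n).trans
      ((hs n).1.trans (exists_increasing_sublist_iff hT'.2 hb' n).symm)
  · refine congrArg sSup (Set.ext fun n => ?_)
    exact (exists_decreasing_sublist_iff hT hb n).trans
      ((hs n).2.trans (exists_decreasing_sublist_iff hT' hb' n).symm)
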